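/- Let k, h > 0, α ∈ (0,1), and let w ∈ C^{1,α}_{2π,0} satisfy W_{kh}(w)(t) > 0 for all t ∈ ℝ. Suppose B is a complex-valued function, continuous and nowhere vanishing on the closed strip {z ∈ ℂ : −kh ≤ Im z ≤ 0}, holomorphic on the open strip, 2π-periodic, real-valued on the line Im z = −kh, whose boundary values on the real axis are B(x) = (1 + C_{kh}w'(x)) + i w'(x) for all x ∈ ℝ. Then (1/2π)∫_{−π}^{π} (1 + C_{kh}w'(t)) / W_{kh}(w)(t) dt > 0. -/

import Mathlib

open Real MeasureTheory Filter

/-- hyperbolic cotangent -/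
noncomputable def coth (x : ℝ) : ℝ := Real.cosh x / Real.sinh x

/-- mean of a `2π`-periodic function over one period -/
noncomputable def mean2 (f : ℝ → ℝ) : ℝ := (1 / (2 * π)) * ∫ t in (-π)..π, f t

/-- cosine Fourier coefficient -/
noncomputable def fcos (f : ℝ → ℝ) (n : ℕ) : ℝ :=
  (1 / π) * ∫ t in (-π)..π, f t * Real.cos (n * t)

/-- sine Fourier coefficient -/
noncomputable def fsin (f : ℝ → ℝ) (n : ℕ) : ℝ :=
  (1 / π) * ∫ t in (-π)..π, f t * Real.sin (n * t)

/-- `g` is the continuous (Hölder) representative of `C_d f`. -/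
def IsConjFn (d : ℝ) (f g : ℝ → ℝ) : Prop :=
  Continuous g ∧ Function.Periodic g (2 * π) ∧ mean2 g = 0 ∧
    ∀ n : ℕ, 0 < n →
      fcos g n = - coth (n * d) * fsin f n ∧ fsin g n = coth (n * d) * fcos f n

/-- Cauchy: period integrals over the two edges of the strip agree. -/
theorem strip_shift (d : ℝ) (hd : 0 < d) (f : ℂ → ℂ)
    (hcont : ContinuousOn f {z : ℂ | -d ≤ z.im ∧ z.im ≤ 0})
    (hhol : DifferentiableOn ℂ f {z : ℂ | -d < z.im ∧ z.im < 0})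
    (hper : ∀ z : ℂ, -d ≤ z.im → z.im ≤ 0 → f (z + (2 * π : ℝ)) = f z) :
    ∫ x in (-π)..π, f (x : ℂ) = ∫ x in (-π)..π, f ((x : ℂ) - d * Complex.I) := by
  have key := Complex.integral_boundary_rect_eq_zero_of_continuousOn_of_differentiableOn f
    (⟨-π, -d⟩ : ℂ) (⟨π, 0⟩ : ℂ)
    (hcont.mono (by
      intro z hz
      have h2 := hz.2
      simp only [Set.mem_preimage, Set.uIcc_of_le (show -d ≤ 0 by linarith)] at h2
      exact h2))
    (hhol.mono (by
      intro z hz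
      have h2 := hz.2
      simp only [Set.mem_preimage, min_eq_left (show -d ≤ 0 by linarith),
        max_eq_right (show -d ≤ 0 by linarith)] at h2
      exact h2))
  simp only at key
  have hv : (∫ y in (-d)..0, f ((π : ℝ) + y * Complex.I))
      = ∫ y in (-d)..0, f ((-π : ℝ) + y * Complex.I) := by
    apply intervalIntegral.integral_congr
    intro y hy
    rw [Set.uIcc_of_le (show -d ≤ 0 by linarith)] at hy
    have := hper ((-π : ℝ) + y * Complex.I) (by simpa using hy.1) (by simpa using hy.2)
    simp only
    rw [← this]
    congr 1
    push_cast
    ring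
  rw [hv, add_sub_cancel_right] at key
  have := sub_eq_zero.mp key
  simp only [Complex.ofReal_zero, zero_mul, add_zero] at this
  rw [← this]
  congr 1
  ext x
  congr 1
  push_cast
  ring

/-- for `w ∈ C^{1,α}_{2π,0}` with `W_{kh}(w) > 0` everywhere, if the
holomorphic extension `B` of `(1 + C_{kh}w') + i w'` to the strip (continuous on the
closed strip, `2π`-periodic, real on the bottom) is nowhere vanishing on the closed
strip, then the mean of `(1 + C_{kh}w')/W_{kh}(w)` over one period is positive. -/
theorem stmt7 (k h : ℝ) (hk : 0 < k) (hh : 0 < h)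
    (α : NNReal) (hα0 : 0 < α) (hα1 : α < 1)
    (w Cw' : ℝ → ℝ)
    (hw : ContDiff ℝ 1 w) (hwper : Function.Periodic w (2 * π)) (hwmean : mean2 w = 0)
    (hwHold : ∃ C : NNReal, HolderWith C α (deriv w))
    (hCw' : IsConjFn (k * h) (deriv w) Cw')
    (hWpos : ∀ t : ℝ, 0 < (deriv w t) ^ 2 + (1 + Cw' t) ^ 2)
    (B : ℂ → ℂ)
    (hcont : ContinuousOn B {z : ℂ | -(k * h) ≤ z.im ∧ z.im ≤ 0})
    (hne : ∀ z : ℂ, -(k * h) ≤ z.im → z.im ≤ 0 → B z ≠ 0)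
    (hhol : DifferentiableOn ℂ B {z : ℂ | -(k * h) < z.im ∧ z.im < 0})
    (hper : ∀ z : ℂ, -(k * h) ≤ z.im → z.im ≤ 0 → B (z + (2 * π : ℝ)) = B z)
    (hreal : ∀ x : ℝ, (B (x - (k * h) * Complex.I)).im = 0)
    (hbnd : ∀ x : ℝ, B x = ((1 + Cw' x : ℝ) : ℂ) + (deriv w x : ℝ) * Complex.I) :
    0 < mean2 (fun t => (1 + Cw' t) / ((deriv w t) ^ 2 + (1 + Cw' t) ^ 2)) := by
  set d := k * h with hd
  have hdpos : 0 < d := mul_pos hk hh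
  have hdc : (k : ℂ) * h = (d : ℂ) := by rw [hd]; push_cast; rfl
  rw [hdc] at hreal
  have hmem : ∀ x : ℝ, -d ≤ ((x : ℂ) - d * Complex.I).im ∧ ((x : ℂ) - d * Complex.I).im ≤ 0 := by
    intro x
    simp [hdpos.le]
  have e1 := strip_shift d hdpos B hcont hhol hper
  have e2 := strip_shift d hdpos (fun z => (B z)⁻¹)
    (hcont.inv₀ (fun z hz => hne z hz.1 hz.2))
    (hhol.inv (fun z hz => hne z hz.1.le hz.2.le))
    (fun z h1 h2 => by rw [hper z h1 h2])
  set b : ℝ → ℝ := fun x => (B ((x : ℂ) - d * Complex.I)).re with hb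
  have hbB : ∀ x : ℝ, B ((x : ℂ) - d * Complex.I) = (b x : ℂ) := by
    intro x
    apply Complex.ext
    · simp [hb]
    · simpa using hreal x
  have hbc : Continuous b := by
    have : Continuous fun x : ℝ => B ((x : ℂ) - d * Complex.I) :=
      hcont.comp_continuous (by fun_prop) hmem
    exact Complex.continuous_re.comp this
  have hb0 : ∀ x, b x ≠ 0 := by
    intro x hx
    apply hne _ (hmem x).1 (hmem x).2
    rw [hbB, hx]; simp
  have htop : Continuous fun x : ℝ => B (x : ℂ) :=
    hcont.comp_continuous (by fun_prop) (fun x => by simp [hdpos.le])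
  have htop0 : ∀ x : ℝ, B (x : ℂ) ≠ 0 := fun x => hne _ (by simp [hdpos.le]) (by simp)
  have htopi : Continuous fun x : ℝ => (B (x : ℂ))⁻¹ := htop.inv₀ htop0
  have hre : ∀ f : ℝ → ℂ, Continuous f → ∫ x in (-π)..π, (f x).re = (∫ x in (-π)..π, f x).re := by
    intro f hf
    exact Complex.reCLM.intervalIntegral_comp_comm (hf.intervalIntegrable _ _)
  obtain ⟨hCc, -, hCm, -⟩ := hCw'
  have hpi := Real.pi_pos
  have hC0 : ∫ t in (-π)..π, Cw' t = 0 := by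
    unfold mean2 at hCm
    rcases mul_eq_zero.mp hCm with h' | h'
    · have : 0 < 1 / (2 * π) := by positivity
      linarith
    · exact h'
  -- mean of `b` is one
  have hbint : ∫ x in (-π)..π, b x = 2 * π := by
    have h1 : ∫ x in (-π)..π, (B (x : ℂ)).re = 2 * π := by
      have : ∀ x : ℝ, (B (x : ℂ)).re = 1 + Cw' x := by
        intro x; rw [hbnd]; simp
      simp only [this]
      rw [intervalIntegral.integral_add (by simp) (hCc.intervalIntegrable _ _), hC0]
      simp; ring
    rw [← h1, hre _ htop, e1]
    simp only [hbB]
    rw [intervalIntegral.integral_ofReal, Complex.ofReal_re]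
  have hbpos : ∀ x, 0 < b x := by
    have hex : ∃ x, 0 < b x := by
      by_contra hcon
      push Not at hcon
      have : 0 ≤ ∫ x in (-π)..π, -b x :=
        intervalIntegral.integral_nonneg (by linarith) (fun x _ => by linarith [hcon x])
      rw [intervalIntegral.integral_neg, hbint] at this
      linarith
    obtain ⟨x0, hx0⟩ := hex
    intro x
    by_contra hx
    push Not at hx
    obtain ⟨y, hy⟩ := mem_range_of_exists_le_of_exists_ge hbc ⟨x, hx⟩ ⟨x0, hx0.le⟩
    exact hb0 y hy
  have hfin : ∫ t in (-π)..π, (1 + Cw' t) / ((deriv w t) ^ 2 + (1 + Cw' t) ^ 2)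
      = ∫ t in (-π)..π, (b t)⁻¹ := by
    have : ∀ t : ℝ, (1 + Cw' t) / ((deriv w t) ^ 2 + (1 + Cw' t) ^ 2) = ((B (t : ℂ))⁻¹).re := by
      intro t
      rw [hbnd, Complex.inv_re, Complex.normSq_apply]
      simp
      ring_nf
    simp only [this]
    rw [hre _ htopi, e2]
    simp only [hbB, ← Complex.ofReal_inv]
    rw [intervalIntegral.integral_ofReal, Complex.ofReal_re]
  unfold mean2
  rw [hfin]
  apply mul_pos (by positivity)
  apply intervalIntegral.intervalIntegral_pos_of_pos _ (fun x => inv_pos.mpr (hbpos x)) (by linarith)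
  exact (hbc.inv₀ hb0).intervalIntegrable _ _
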